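/- If A ⊆ F_5^n is sum-free and |A| > 1.2 · 5^{n−1}, then A is normal: there exist a subspace V < F_5^n of codimension 1 and w ∈ F_5^n \ V such that A ⊆ {2w, 3w} + V. -/

import Mathlib

open Pointwise

/-- The size of a union of cosets of `H` is a multiple of the size of `H`. -/
theorem card_dvd_ncard_of_add_mem {G : Type*} [AddCommGroup G] [Finite G] {H : AddSubgroup G}
    {T : Set G} (hT : ∀ h ∈ H, ∀ x ∈ T, x + h ∈ T) : Nat.card H ∣ T.ncard := by
  have h : T = ((↑) : G → G ⧸ H) ⁻¹' (((↑) : G → G ⧸ H) '' T) := by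
    refine (Set.subset_preimage_image _ _).antisymm ?_
    rintro x ⟨y, hy, hxy⟩
    have := hT _ (QuotientAddGroup.eq.1 hxy) y hy
    rwa [add_neg_cancel_left] at this
  rw [h, ← Nat.card_coe_set_eq,
    Nat.card_congr (QuotientAddGroup.preimageMkEquivAddSubgroupProdSet H _), Nat.card_prod]
  exact dvd_mul_right _ _

/-- Dyson's `e`-transform shrinks `Y` until a translate of a periodic set lies inside `X + Y`. -/
theorem exists_periodic_translate {G : Type*} [AddCommGroup G] [Finite G] [DecidableEq G]
    (Y : Finset G) : ∀ X : Finset G, X.Nonempty → Y.Nonempty →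
    ∃ (H : AddSubgroup G) (X' : Finset G) (b : G), X'.Nonempty ∧
      (∀ h ∈ H, ∀ x ∈ X', x + h ∈ X') ∧ X.card + Y.card ≤ X'.card + Nat.card H ∧
      ∀ x ∈ X', x + b ∈ X + Y := by
  induction Y using Finset.strongInduction with
  | H Y ih =>
    rintro X hX ⟨b, hb⟩
    by_cases hstable : ∀ x ∈ X, ∀ y ∈ Y, ∀ y' ∈ Y, x - y + y' ∈ X
    · refine ⟨AddAction.stabilizer G X, X, b, hX, fun h hh x hx => ?_, ?_,
        fun x hx => Finset.add_mem_add hx hb⟩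
      · rw [← AddAction.mem_stabilizer_iff.1 hh, add_comm]
        exact Finset.vadd_mem_vadd_finset hx
      · gcongr
        have hmem (y : Y) : (y : G) - b ∈ AddAction.stabilizer G X := by
          refine Finset.eq_of_subset_of_card_le (fun z hz => ?_) (Finset.card_vadd_finset _ _).ge
          obtain ⟨x, hx, rfl⟩ := Finset.mem_vadd_finset.1 hz
          have := hstable x hx b hb y y.2
          rw [vadd_eq_add]
          convert this using 1
          abel
        rw [← Nat.card_eq_finsetCard]
        exact Nat.card_le_card_of_injective (fun y => (⟨_, hmem y⟩ : AddAction.stabilizer G X))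
          fun y z hyz => Subtype.ext (sub_left_injective (Subtype.ext_iff.1 hyz))
    · push Not at hstable
      obtain ⟨x, hx, y, hy, y', hy', hxy⟩ := hstable
      have hsub := Finset.addDysonETransform.subset (x - y) (X, Y)
      have hcard := Finset.addDysonETransform.card (x - y) (X, Y)
      simp only [Finset.addDysonETransform_fst, Finset.addDysonETransform_snd] at hsub hcard
      have hy'_notMem : y' ∉ Y ∩ (-(x - y) +ᵥ X) := fun h =>
        hxy (Finset.mem_neg_vadd_finset_iff.1 (Finset.mem_inter.1 h).2)
      have hy_mem : y ∈ Y ∩ (-(x - y) +ᵥ X) := by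
        rw [Finset.mem_inter, Finset.mem_neg_vadd_finset_iff, vadd_eq_add, sub_add_cancel]
        exact ⟨hy, hx⟩
      obtain ⟨H, X', b, hX', hper, hle, hadd⟩ := ih _
        (Finset.inter_subset_left.ssubset_of_mem_notMem hy' hy'_notMem)
        (X ∪ ((x - y) +ᵥ Y)) (hX.mono Finset.subset_union_left) ⟨y, hy_mem⟩
      exact ⟨H, X', b, hX', hper, hcard ▸ hle, fun z hz => hsub (hadd z hz)⟩

theorem exists_card_add_card_add_le {G : Type*} [AddCommGroup G] [Finite G] [DecidableEq G]
    {X Y Z : Finset G} (hX : X.Nonempty) (hY : Y.Nonempty) (hZ : Z.Nonempty)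
    (h : ∀ x ∈ X, ∀ y ∈ Y, x + y ∉ Z) :
    ∃ H : AddSubgroup G, H ≠ ⊤ ∧ ∃ t, Z.card ≤ Nat.card H * t ∧
      X.card + Y.card + Nat.card H * t ≤ Nat.card G + Nat.card H := by
  obtain ⟨H, X', b, ⟨x, hx⟩, hper, hle, hadd⟩ := exists_periodic_translate Y X hX hY
  have hnot {z : G} (hz : z ∈ Z) : z - b ∉ X' := by
    intro hzb
    obtain ⟨x, hx, y, hy, hxy⟩ := Finset.mem_add.1 (hadd _ hzb)
    rw [sub_add_cancel] at hxy
    exact h x hx y hy (hxy ▸ hz)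
  have hper' : ∀ h ∈ H, ∀ x ∈ {x | x - b ∉ X'}, x + h ∈ {x | x - b ∉ X'} := by
    intro h hh x hx hmem
    refine hx ?_
    have := hper _ (H.neg_mem hh) _ hmem
    convert this using 1
    abel
  obtain ⟨t, ht⟩ := card_dvd_ncard_of_add_mem hper'
  refine ⟨H, ?_, t, ?_, ?_⟩
  · rintro rfl
    obtain ⟨z, hz⟩ := hZ
    refine hnot hz ?_
    have := hper (z - b - x) (AddSubgroup.mem_top _) x hx
    rwa [add_sub_cancel] at this
  · rw [← ht, ← Set.ncard_coe_finset]
    exact Set.ncard_le_ncard fun z hz => hnot hz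
  · have hcompl := Set.ncard_add_ncard_compl {x | x - b ∉ X'}
    have hcard : {x | x - b ∉ X'}ᶜ.ncard = X'.card := by
      rw [← Set.ncard_coe_finset, ← Set.ncard_image_of_injective _ (sub_left_injective (b := b))]
      congr 1
      ext y
      constructor
      · rintro ⟨x, hx, rfl⟩
        exact not_not.1 hx
      · intro hy
        exact ⟨y + b, by simpa using hy, by simp⟩
    omega

theorem fact_prime_five : Fact (Nat.Prime 5) :=
  ⟨by norm_num⟩

section PrimeFive

attribute [local instance] fact_prime_five

/-- The numerical constraints that a triple of cells `x`, `y`, `x + y` of a sum-free set satisfies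
when all three cells, of sizes `a`, `b`, `c` inside a coset of size `N`, are nonempty. -/
structure SchurBound (N a b c : ℕ) : Prop where
  sum_le : 5 * (a + b + c) ≤ 6 * N
  left : ∀ k, k * N < 5 * a → 5 * (b + c) + k * N ≤ 5 * N
  mid : ∀ k, k * N < 5 * b → 5 * (a + c) + k * N ≤ 5 * N
  right : ∀ k, k * N < 5 * c → 5 * (a + b) + k * N ≤ 5 * N

section Module

variable {G : Type*} [AddCommGroup G] [Module (ZMod 5) G] [Finite G]

theorem five_mul_card_dvd_card {H : AddSubgroup G} (hH : H ≠ ⊤) :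
    5 * Nat.card H ∣ Nat.card G := by
  have hindex : H.index ∣ 5 ^ Module.finrank (ZMod 5) G := by
    have hcard := Module.natCard_eq_pow_finrank (K := ZMod 5) (V := G)
    rw [Nat.card_zmod] at hcard
    rw [← hcard]
    exact H.index_dvd_card
  obtain ⟨m, -, hm⟩ := (Nat.dvd_prime_pow Fact.out).1 hindex
  rw [← H.card_mul_index, mul_comm 5]
  refine mul_dvd_mul_left _ (hm ▸ dvd_pow_self 5 ?_)
  rintro rfl
  exact hH (AddSubgroup.index_eq_one.1 hm)

theorem card_add_card_le_of_add_notMem {X Y Z : Finset G} (hX : X.Nonempty) (hY : Y.Nonempty)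
    (hZ : Z.Nonempty) (h : ∀ x ∈ X, ∀ y ∈ Y, x + y ∉ Z) :
    5 * (X.card + Y.card + Z.card) ≤ 6 * Nat.card G ∧
      ∀ k, k * Nat.card G < 5 * Z.card →
        5 * (X.card + Y.card) + k * Nat.card G ≤ 5 * Nat.card G := by
  classical
  obtain ⟨H, hH, t, ht, hle⟩ := exists_card_add_card_add_le hX hY hZ h
  obtain ⟨q, hq⟩ := five_mul_card_dvd_card hH
  have hq0 : 0 < q := by
    have : 0 < Nat.card G := Nat.card_pos
    by_contra! hq0
    simp_all
  constructor
  · have : Nat.card H * 1 ≤ Nat.card H * q := Nat.mul_le_mul_left _ hq0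
    rw [mul_assoc] at hq
    omega
  · intro k hk
    have hlt : k * q < t := by
      refine Nat.lt_of_mul_lt_mul_left (a := 5 * Nat.card H) ?_
      calc 5 * Nat.card H * (k * q) = k * Nat.card G := by rw [hq]; ring
        _ < 5 * Nat.card H * t := by rw [mul_assoc]; omega
    have := Nat.mul_le_mul_left (Nat.card H) hlt
    rw [hq] at hle ⊢
    nlinarith

theorem SchurBound.of_add_notMem {X Y Z : Finset G} (hX : X.Nonempty) (hY : Y.Nonempty)
    (hZ : Z.Nonempty) (h : ∀ x ∈ X, ∀ y ∈ Y, x + y ∉ Z) :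
    SchurBound (Nat.card G) X.card Y.card Z.card := by
  classical
  obtain ⟨hsum, hright⟩ := card_add_card_le_of_add_notMem hX hY hZ h
  refine ⟨hsum, fun k hk => ?_, fun k hk => ?_, hright⟩
  · rw [add_comm Y.card, ← Finset.card_neg Y]
    refine (card_add_card_le_of_add_notMem hZ hY.neg hX fun z hz y hy hx => ?_).2 k hk
    exact h _ hx _ (Finset.mem_neg'.1 hy) (by rwa [add_neg_cancel_right])
  · rw [add_comm X.card, ← Finset.card_neg X]
    refine (card_add_card_le_of_add_notMem hZ hX.neg hY fun z hz x hx hy => ?_).2 k hk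
    exact h _ (Finset.mem_neg'.1 hx) _ hy (by rwa [neg_add_cancel_comm_assoc])

/-- The constraints of `SchurBound` hold for the parts of a sum-free set in cosets of a kernel. -/
theorem SchurBound.of_fiber {E : Type*} [AddCommGroup E] [Module (ZMod 5) E] [DecidableEq E]
    (φ : G →ₗ[ZMod 5] E) {A : Finset G} (hA : ∀ a ∈ A, ∀ b ∈ A, a + b ∉ A) {x y : E}
    (hx : 0 < (A.filter (φ · = x)).card) (hy : 0 < (A.filter (φ · = y)).card)
    (hxy : 0 < (A.filter (φ · = x + y)).card) :
    SchurBound (Nat.card (LinearMap.ker φ)) (A.filter (φ · = x)).card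
      (A.filter (φ · = y)).card (A.filter (φ · = x + y)).card := by
  classical
  obtain ⟨x₀, hx₀⟩ := Finset.card_pos.1 hx
  obtain ⟨y₀, hy₀⟩ := Finset.card_pos.1 hy
  rw [Finset.mem_filter] at hx₀ hy₀
  have : Fintype (LinearMap.ker φ) := Fintype.ofFinite _
  have key (z : E) (z₀ : G) (hz₀ : φ z₀ = z) : (A.filter (φ · = z)).card =
      (Finset.univ.filter fun v : LinearMap.ker φ => z₀ + v ∈ A).card := by
    symm
    refine Finset.card_nbij (fun v => z₀ + v) ?_ ?_ ?_
    · intro v hv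
      have := v.2
      simp_all
    · intro v _ w _ hvw
      exact Subtype.ext (add_left_cancel hvw)
    · intro a ha
      simp only [Finset.coe_filter, Set.mem_ofPred_eq] at ha
      exact ⟨⟨a - z₀, by simp [ha.2, hz₀]⟩, by simp [ha.1], by simp⟩
  rw [key x x₀ hx₀.2, key y y₀ hy₀.2, key (x + y) (x₀ + y₀) (by simp [hx₀.2, hy₀.2])] at *
  refine .of_add_notMem (Finset.card_pos.1 hx) (Finset.card_pos.1 hy) (Finset.card_pos.1 hxy) ?_
  simp only [Finset.mem_filter, Finset.mem_univ, true_and]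
  intro v hv w hw hvw
  refine hA _ hv _ hw ?_
  rwa [add_add_add_comm]

end Module

/-- The numerical constraints on the sizes `c i j` of the 25 cells of a dense sum-free set that is
normal in the hyperplane `i = 0`, with values `1` and `4` there, but has no dense cell along a
functional `j - a * i`. -/
structure IsCellCount (N : ℕ) (c : ZMod 5 → ZMod 5 → ℕ) : Prop where
  le : ∀ i j, c i j ≤ N
  schur : ∀ i j k l, 0 < c i j → 0 < c k l → 0 < c (i + k) (j + l) →
    SchurBound N (c i j) (c k l) (c (i + k) (j + l))
  line : ∀ a s, 2 * ∑ i, c i (a * i + s) ≤ 5 * N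
  zero_apply : ∀ j, j ≠ 1 → j ≠ 4 → c 0 j = 0
  lt_zero_row : 6 * N < 5 * (c 0 1 + c 0 4)
  lt_sum : 6 * N < ∑ i, ∑ j, c i j

theorem sum_zmod_five (f : ZMod 5 → ℕ) : ∑ i, f i = f 0 + f 1 + f 2 + f 3 + f 4 :=
  Fin.sum_univ_five f

namespace IsCellCount

variable {N : ℕ} {c : ZMod 5 → ZMod 5 → ℕ}

theorem pair_add (hc : IsCellCount N c) (i j k l : ZMod 5) (h : 0 < c (i + k) (j + l)) :
    c i j + c k l ≤ N := by
  have h1 := hc.le i j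
  have h2 := hc.le k l
  rcases (c i j).eq_zero_or_pos with h3 | h3
  · omega
  rcases (c k l).eq_zero_or_pos with h4 | h4
  · omega
  have := (hc.schur i j k l h3 h4 h).right 0 (by omega)
  omega

theorem strong_add (hc : IsCellCount N c) (m : ℕ) (i j k l : ZMod 5) (h1 : 0 < c i j)
    (h2 : 0 < c k l) (h : m * N < 5 * c (i + k) (j + l)) :
    5 * (c i j + c k l) + m * N ≤ 5 * N :=
  (hc.schur i j k l h1 h2 (by omega)).right m h

theorem strong_sub (hc : IsCellCount N c) (m : ℕ) (i j k l : ZMod 5) (h1 : 0 < c i j)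
    (h2 : 0 < c k l) (h : m * N < 5 * c (k - i) (l - j)) :
    5 * (c i j + c k l) + m * N ≤ 5 * N := by
  have := hc.schur i j (k - i) (l - j) h1 (by omega)
  rw [add_sub_cancel, add_sub_cancel] at this
  exact (this h2).mid m h

theorem pair_sub (hc : IsCellCount N c) (i j k l : ZMod 5) (h : 0 < c (k - i) (l - j)) :
    c i j + c k l ≤ N := by
  have h1 := hc.le i j
  have h2 := hc.le k l
  rcases (c i j).eq_zero_or_pos with h3 | h3
  · omega
  rcases (c k l).eq_zero_or_pos with h4 | h4
  · omega
  have := hc.strong_sub 0 i j k l h3 h4 (by omega)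
  omega

theorem triple_le (hc : IsCellCount N c) {i j k l m n : ZMod 5} (h1 : 0 < c i j) (h2 : 0 < c k l)
    (h3 : 0 < c m n) (hm : i + k = m := by decide) (hn : j + l = n := by decide) :
    5 * (c i j + c k l + c m n) ≤ 6 * N := by
  subst hm hn
  exact (hc.schur i j k l h1 h2 h3).sum_le

theorem line_le (hc : IsCellCount N c) (a s : ZMod 5) :
    2 * (c 0 (a * 0 + s) + c 1 (a * 1 + s) + c 2 (a * 2 + s) + c 3 (a * 3 + s) +
      c 4 (a * 4 + s)) ≤ 5 * N := by
  rw [← sum_zmod_five fun i => c i (a * i + s)]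
  exact hc.line a s

theorem comp (hc : IsCellCount N c) {u ε : ZMod 5} (hu : u ≠ 0) (hε : ε = 1 ∨ ε = -1)
    (a : ZMod 5) : IsCellCount N fun i j => c (u * i) (ε * j + a * i) := by
  have hε0 : ε ≠ 0 := by rcases hε with rfl | rfl <;> decide
  have hcol (i : ZMod 5) : ∑ j, c (u * i) (ε * j + a * i) = ∑ j, c (u * i) j :=
    Equiv.sum_comp ((Equiv.mulLeft₀ ε hε0).trans (Equiv.addRight (a * i))) (c (u * i))
  refine ⟨fun i j => hc.le _ _, fun i j k l h1 h2 h3 => ?_, fun b s => ?_, fun j h1 h4 => ?_, ?_, ?_⟩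
  · have e1 : u * (i + k) = u * i + u * k := by ring
    have e2 : ε * (j + l) + a * (i + k) = ε * j + a * i + (ε * l + a * k) := by ring
    simp only [e1, e2] at h3 ⊢
    exact hc.schur _ _ _ _ h1 h2 h3
  · have := hc.line ((ε * b + a) * u⁻¹) (ε * s)
    rw [← Equiv.sum_comp (Equiv.mulLeft₀ u hu)] at this
    have e (i : ZMod 5) :
        ε * (b * i + s) + a * i = (ε * b + a) * u⁻¹ * (u * i) + ε * s := by
      rw [mul_assoc, inv_mul_cancel_left₀ hu]
      ring
    simp only [e]
    exact this
  · simp only [mul_zero, add_zero]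
    apply hc.zero_apply <;> rcases hε with rfl | rfl <;> revert j <;> decide
  · have := hc.lt_zero_row
    rcases hε with rfl | rfl
    · simpa using this
    · simp only [mul_zero, add_zero]
      rw [add_comm] at this
      exact this
  · simp only [hcol]
    exact hc.lt_sum.trans_eq (Equiv.sum_comp (Equiv.mulLeft₀ u hu) fun i => ∑ j, c i j).symm

theorem eq_zero_of_adjacent {r : ZMod 5 → ℕ} (a : ZMod 5) (hle : ∀ j, r j ≤ N)
    (hadj : ∀ j, 0 < r j → 0 < r (j + 1) → 5 * (r j + r (j + 1)) ≤ 2 * N)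
    (hr : N < ∑ j, r j) (h2 : 0 < r (2 + a)) (h3 : 0 < r (3 + a)) :
    r (1 + a) = 0 ∧ r (4 + a) = 0 ∧ 3 * N < 5 * r a := by
  have hadj' (i j : ZMod 5) (h : i + 1 = j) (hi : 0 < r (i + a)) (hj : 0 < r (j + a)) :
      5 * (r (i + a) + r (j + a)) ≤ 2 * N := by
    have e : j + a = i + a + 1 := by rw [← h]; ring
    rw [e] at hj ⊢
    exact hadj _ hi hj
  rw [← Equiv.sum_comp (Equiv.addRight a), sum_zmod_five] at hr
  simp only [Equiv.coe_addRight] at hr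
  have h0 := hle (0 + a)
  have h1 := hle (1 + a)
  have h4 := hle (4 + a)
  have a0 := hadj' 0 1 rfl
  have a1 := hadj' 1 2 rfl
  have a2 := hadj' 2 3 rfl
  have a3 := hadj' 3 4 rfl
  have a4 := hadj' 4 0 rfl
  rw [zero_add] at *
  omega

/-- A row of size more than `N` has, up to a shift, exactly two nonadjacent nonempty cells, or a
large cell together with the two cells that are not adjacent to it. -/
theorem exists_shift_row {r : ZMod 5 → ℕ} (hle : ∀ j, r j ≤ N)
    (hadj : ∀ j, 0 < r j → 0 < r (j + 1) → 5 * (r j + r (j + 1)) ≤ 2 * N)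
    (hr : N < ∑ j, r j) :
    ∃ a, r a = 0 ∧ r (2 + a) = 0 ∧ r (3 + a) = 0 ∧ 0 < r (1 + a) ∧ 0 < r (4 + a) ∧
        N < r (1 + a) + r (4 + a) ∨
      r (1 + a) = 0 ∧ r (4 + a) = 0 ∧ 3 * N < 5 * r a ∧ 0 < r (2 + a) ∧ 0 < r (3 + a) := by
  by_cases hpair : ∃ a, 0 < r (2 + a) ∧ 0 < r (3 + a)
  · obtain ⟨a, h2, h3⟩ := hpair
    obtain ⟨h1, h4, h0⟩ := eq_zero_of_adjacent a hle hadj hr h2 h3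
    exact ⟨a, .inr ⟨h1, h4, h0, h2, h3⟩⟩
  have hadj' (i j : ZMod 5) (h : i + 1 = j) (hi : 0 < r i) : r j = 0 := by
    by_contra hj
    refine hpair ⟨i - 2, ?_, ?_⟩
    · rwa [add_sub_cancel]
    · rw [← h] at hj
      convert Nat.pos_of_ne_zero hj using 2
      ring
  by_cases hpair' : ∃ a, 0 < r (1 + a) ∧ 0 < r (4 + a)
  · obtain ⟨a, h1, h4⟩ := hpair'
    have h0 := hadj' (4 + a) a (by rw [add_right_comm]; exact zero_add a) h4
    have h2 := hadj' (1 + a) (2 + a) (by rw [add_right_comm]; rfl) h1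
    have h3 : r (3 + a) = 0 := by
      by_contra h3
      have := hadj' (3 + a) (4 + a) (by rw [add_right_comm]; rfl) (Nat.pos_of_ne_zero h3)
      omega
    rw [← Equiv.sum_comp (Equiv.addRight a), sum_zmod_five] at hr
    simp only [Equiv.coe_addRight, zero_add] at hr
    exact ⟨a, .inl ⟨h0, h2, h3, h1, h4, by omega⟩⟩
  push Not at hpair'
  have h0 := hle 0
  have h1 := hle 1
  have h2 := hle 2
  have h3 := hle 3
  have h4 := hle 4
  have a0 := hadj' 0 1 rfl
  have a1 := hadj' 1 2 rfl
  have a2 := hadj' 2 3 rfl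
  have a3 := hadj' 3 4 rfl
  have a4 := hadj' 4 0 rfl
  have b0 : 0 < r 1 → r 4 ≤ 0 := hpair' 0
  have b1 : 0 < r 2 → r 0 ≤ 0 := hpair' 1
  have b2 : 0 < r 3 → r 1 ≤ 0 := hpair' 2
  have b3 : 0 < r 4 → r 2 ≤ 0 := hpair' 3
  have b4 : 0 < r 0 → r 3 ≤ 0 := hpair' 4
  rw [sum_zmod_five] at hr
  omega

theorem not_two_point_row (hc : IsCellCount N c) (h01B : 3 * N < 5 * c 0 1)
    (hr : c 2 0 + c 2 1 + c 2 2 + c 2 3 + c 2 4 + (c 3 0 + c 3 1 + c 3 2 + c 3 3 + c 3 4) ≤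
      c 1 0 + c 1 1 + c 1 2 + c 1 3 + c 1 4 + (c 4 0 + c 4 1 + c 4 2 + c 4 3 + c 4 4))
    (hr' : c 4 0 + c 4 1 + c 4 2 + c 4 3 + c 4 4 ≤ c 1 0 + c 1 1 + c 1 2 + c 1 3 + c 1 4)
    (h10 : c 1 0 = 0) (h12 : c 1 2 = 0) (h13 : c 1 3 = 0) (h11 : 0 < c 1 1) (h14 : 0 < c 1 4)
    (h : N < c 1 1 + c 1 4) : False := by
  have hle := hc.le
  have h00 := hc.zero_apply 0 (by decide) (by decide)
  have h02 := hc.zero_apply 2 (by decide) (by decide)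
  have h03 := hc.zero_apply 3 (by decide) (by decide)
  have hz := hc.lt_zero_row
  have ht := hc.lt_sum
  simp only [sum_zmod_five] at ht
  have h1 := hle 0 1
  have h2 := hle 0 4
  have h01 : 0 < c 0 1 := by omega
  have h04 : 0 < c 0 4 := by omega
  have pairAdd := hc.pair_add
  have pairSub := hc.pair_sub
  have strongAdd := hc.strong_add
  have strongSub := hc.strong_sub
  have h20 : c 2 0 = 0 := by
    by_contra h20
    have := pairAdd 1 1 1 4 (Nat.pos_of_ne_zero h20)
    omega
  have l01 : 2 * (c 0 1 + c 1 1 + c 2 1 + c 3 1 + c 4 1) ≤ 5 * N := hc.line_le 0 1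
  have l04 : 2 * (c 0 4 + c 1 4 + c 2 4 + c 3 4 + c 4 4) ≤ 5 * N := hc.line_le 0 4
  have l24 : 2 * (c 0 4 + c 1 1 + c 2 3 + c 3 0 + c 4 2) ≤ 5 * N := hc.line_le 2 4
  have l31 : 2 * (c 0 1 + c 1 4 + c 2 2 + c 3 0 + c 4 3) ≤ 5 * N := hc.line_le 3 1
  rcases (c 4 0).eq_zero_or_pos with h40 | h40
  · rcases (c 3 0).eq_zero_or_pos with h30 | h30
    · rcases (c 2 2).eq_zero_or_pos with h22 | h22
      · rcases (c 2 3).eq_zero_or_pos with h23 | h23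
        · rcases le_or_gt (5 * c 3 2) (1 * N) with h32b | h32b
          · rcases (c 3 3).eq_zero_or_pos with h33 | h33
            · linarith [l01, l04, pairSub 4 2 0 1 h14, pairSub 4 3 0 4 h11]
            · linarith [pairAdd 0 4 3 4 h33, pairSub 2 1 0 4 h33, l01, pairAdd 1 4 2 4 h33,
                pairSub 3 1 1 4 h33, pairSub 0 1 3 4 h33, pairSub 4 2 0 1 h14,
                pairAdd 1 1 4 3 h04, pairSub 1 1 4 4 h33, hc.triple_le h33 h33 h11]
          · have h32 : 0 < c 3 2 := by omega
            linarith [pairSub 0 4 3 1 h32, pairAdd 1 1 2 1 h32, pairSub 2 4 0 1 h32,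
              strongSub 1 3 2 1 4 h32 h14 h32b, pairSub 0 1 3 3 h32, pairSub 3 4 1 1 h32]
        · rcases (c 3 2).eq_zero_or_pos with h32 | h32
          · linarith [pairSub 2 1 4 4 h23, pairAdd 0 4 2 4 h23, l01, hc.triple_le h14 h14 h23,
              pairSub 0 1 2 4 h23, pairSub 4 2 0 1 h14, pairSub 3 3 0 1 h23, pairSub 1 1 3 4 h23,
              pairAdd 1 1 4 3 h04, pairSub 3 1 0 4 h23]
          · linarith [pairAdd 0 4 2 4 h23, pairAdd 1 1 2 1 h32, hc.triple_le h14 h14 h23,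
              pairAdd 0 1 3 1 h32, hc.triple_le h32 h32 h14, pairSub 0 1 3 3 h32,
              pairSub 1 1 3 4 h23, hc.triple_le h14 h23 h32]
      · rcases (c 3 3).eq_zero_or_pos with h33 | h33
        · rcases (c 2 3).eq_zero_or_pos with h23 | h23
          · linarith [l04, pairSub 3 2 0 4 h22, pairAdd 0 1 2 1 h22, hc.triple_le h11 h11 h22,
              pairSub 2 4 4 1 h22, pairSub 1 4 3 1 h22, pairSub 3 4 0 1 h22, pairAdd 1 4 4 2 h01,
              pairAdd 2 4 3 2 h01, l31, pairSub 4 3 0 4 h11]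
          · linarith [pairSub 0 4 2 1 h22, pairAdd 1 4 1 4 h23, pairAdd 0 1 2 1 h22,
              strongSub 3 2 2 2 3 h22 h23 h01B, pairSub 3 4 0 1 h22, pairSub 0 1 2 4 h23,
              pairSub 3 1 0 4 h23, pairSub 3 2 0 4 h22, pairAdd 1 1 1 1 h22]
        · rcases (c 3 2).eq_zero_or_pos with h32 | h32
          · linarith [pairAdd 1 1 1 1 h22, pairSub 1 4 2 3 h14, pairSub 0 4 2 1 h22,
              pairAdd 0 4 2 3 h22, hc.triple_le h11 h11 h22, pairSub 0 1 2 3 h22,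
              pairAdd 1 4 2 4 h33, pairSub 1 4 3 1 h22, pairSub 0 1 3 4 h33,
              hc.triple_le h33 h33 h11]
          · linarith [pairSub 0 4 2 1 h22, hc.triple_le h11 h11 h22, pairAdd 0 4 2 3 h22,
              pairSub 0 1 2 3 h22, pairSub 1 4 2 3 h14, pairAdd 1 4 2 4 h33, pairSub 1 4 3 1 h22,
              pairAdd 1 1 1 1 h22, strongSub 3 3 2 3 3 h32 h33 h01B, pairSub 0 1 3 4 h33]
    · rcases (c 4 2).eq_zero_or_pos with h42 | h42
      · rcases (c 4 4).eq_zero_or_pos with h44 | h44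
        · rcases (c 2 4).eq_zero_or_pos with h24 | h24
          · linarith [pairSub 3 4 1 4 h30, pairSub 0 1 3 1 h30, pairSub 4 3 0 4 h11,
              pairSub 3 2 4 3 h11, pairSub 1 4 2 3 h14, l31, pairAdd 3 3 3 3 h11,
              pairSub 3 2 3 3 h01, pairAdd 0 1 3 4 h30, pairSub 1 1 4 1 h30, pairAdd 1 4 2 1 h30]
          · linarith [pairSub 1 1 4 1 h30, pairSub 0 1 3 1 h30, pairSub 1 4 2 3 h14,
              pairAdd 1 4 2 1 h30, pairSub 2 4 4 3 h24, pairSub 3 4 1 4 h30, l31,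
              pairSub 3 2 0 1 h24, pairSub 1 4 3 3 h24, pairSub 4 3 0 4 h11]
        · linarith [pairSub 0 4 4 3 h44, pairSub 1 4 4 4 h30, pairSub 1 1 4 1 h30,
            pairAdd 0 1 4 3 h44]
      · rcases (c 4 3).eq_zero_or_pos with h43 | h43
        · linarith [strongAdd 3 1 4 4 2 h14 h42 h01B, pairAdd 1 1 3 1 h42, pairSub 1 4 0 1 h42,
            pairSub 2 1 0 1 h30, pairSub 1 1 2 2 h11, pairAdd 0 4 3 1 h30, pairAdd 1 1 2 4 h30,
            l24, pairSub 3 3 4 4 h11, pairAdd 3 2 3 2 h14, pairSub 0 4 3 4 h30,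
            pairSub 1 1 4 1 h30, pairSub 1 4 4 4 h30]
        · linarith [pairSub 1 4 0 1 h42, pairSub 1 1 0 4 h43]
  · linarith [pairSub 1 4 0 4 h40, pairSub 1 1 0 1 h40]

theorem not_three_point_row (hc : IsCellCount N c) (h01B : 3 * N < 5 * c 0 1)
    (hr : c 2 0 + c 2 1 + c 2 2 + c 2 3 + c 2 4 + (c 3 0 + c 3 1 + c 3 2 + c 3 3 + c 3 4) ≤
      c 1 0 + c 1 1 + c 1 2 + c 1 3 + c 1 4 + (c 4 0 + c 4 1 + c 4 2 + c 4 3 + c 4 4))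
    (hr' : c 4 0 + c 4 1 + c 4 2 + c 4 3 + c 4 4 ≤ c 1 0 + c 1 1 + c 1 2 + c 1 3 + c 1 4)
    (h11 : c 1 1 = 0) (h14 : c 1 4 = 0) (h10B : 3 * N < 5 * c 1 0) (h12 : 0 < c 1 2)
    (h13 : 0 < c 1 3) : False := by
  have hle := hc.le
  have h00 := hc.zero_apply 0 (by decide) (by decide)
  have h02 := hc.zero_apply 2 (by decide) (by decide)
  have h03 := hc.zero_apply 3 (by decide) (by decide)
  have hz := hc.lt_zero_row
  have ht := hc.lt_sum
  simp only [sum_zmod_five] at ht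
  have h1 := hle 0 1
  have h2 := hle 0 4
  have h01 : 0 < c 0 1 := by omega
  have h04 : 0 < c 0 4 := by omega
  have h10 : 0 < c 1 0 := by omega
  have pairAdd := hc.pair_add
  have pairSub := hc.pair_sub
  have strongAdd := hc.strong_add
  have strongSub := hc.strong_sub
  have l14 : 2 * (c 0 4 + c 1 0 + c 2 1 + c 3 2 + c 4 3) ≤ 5 * N := hc.line_le 1 4
  have l41 : 2 * (c 0 1 + c 1 0 + c 2 4 + c 3 3 + c 4 2) ≤ 5 * N := hc.line_le 4 1
  rcases (c 4 4).eq_zero_or_pos with h44 | h44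
  · rcases (c 2 0).eq_zero_or_pos with h20 | h20
    · rcases (c 3 0).eq_zero_or_pos with h30 | h30
      · rcases (c 3 1).eq_zero_or_pos with h31 | h31
        · rcases (c 3 4).eq_zero_or_pos with h34 | h34
          · rcases (c 2 2).eq_zero_or_pos with h22 | h22
            · linarith [strongSub 3 1 2 1 3 h12 h13 h01B, pairSub 4 1 0 4 h13,
                pairSub 4 1 0 1 h10, l14, pairSub 1 0 2 3 h13, l41, pairAdd 2 3 4 0 h13,
                pairSub 4 0 4 1 h01]
            · linarith [strongSub 3 1 2 1 3 h12 h13 h01B, pairSub 0 4 2 1 h22,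
                pairSub 0 1 1 3 h12, pairAdd 0 4 1 3 h12, pairSub 1 0 2 2 h12,
                pairSub 1 0 2 3 h13, l41, pairSub 1 0 3 2 h22, strongSub 3 1 2 2 2 h12 h22 h10B]
          · rcases (c 2 2).eq_zero_or_pos with h22 | h22
            · linarith [pairSub 3 2 4 0 h13, strongSub 3 1 2 1 3 h12 h13 h01B,
                pairSub 0 4 3 3 h34, pairAdd 3 4 3 4 h13, l14, pairSub 1 0 2 3 h13,
                pairAdd 1 0 2 4 h34, pairSub 4 2 0 4 h12, pairSub 4 1 0 1 h10,
                pairSub 2 1 3 4 h13, pairAdd 0 1 3 3 h34]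
            · linarith [strongSub 3 1 2 1 3 h12 h13 h01B, pairSub 0 1 2 3 h22,
                pairSub 0 4 2 1 h22, pairAdd 0 4 2 3 h22, pairSub 1 0 2 3 h13,
                pairAdd 1 0 2 4 h34, pairSub 1 0 3 2 h22, strongAdd 3 2 2 3 4 h22 h34 h01B,
                pairAdd 0 1 3 3 h34]
        · rcases (c 3 4).eq_zero_or_pos with h34 | h34
          · rcases (c 2 3).eq_zero_or_pos with h23 | h23
            · linarith [strongSub 3 1 2 1 3 h12 h13 h01B, pairAdd 3 1 3 1 h12,
                pairAdd 1 0 2 1 h31, pairSub 1 0 2 2 h12, pairSub 4 3 0 1 h13,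
                pairSub 2 4 3 1 h12, l41, pairSub 4 1 0 1 h10, pairSub 4 1 0 4 h13,
                pairAdd 0 4 3 2 h31, pairSub 3 3 4 0 h12]
            · linarith [strongSub 3 1 2 1 3 h12 h13 h01B, pairAdd 0 4 2 4 h23,
                pairAdd 1 0 2 1 h31, pairSub 1 0 2 2 h12, pairSub 0 1 2 4 h23,
                hc.triple_le h23 h31 h04, pairSub 1 0 3 3 h23, pairSub 0 1 3 2 h31]
          · linarith [strongSub 3 1 2 1 3 h12 h13 h01B, pairAdd 0 4 3 2 h31, pairSub 0 4 3 3 h34,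
              pairAdd 1 0 2 1 h31, pairSub 1 0 2 2 h12, pairSub 1 0 2 3 h13, pairAdd 1 0 2 4 h34,
              pairAdd 0 1 3 3 h34, strongAdd 3 3 1 3 4 h31 h34 h10B, pairSub 2 2 0 1 h34]
      · linarith [pairAdd 1 0 4 1 h01, pairSub 4 3 0 1 h13, pairSub 1 0 4 0 h30,
          pairSub 4 2 0 4 h12, strongSub 3 1 2 1 3 h12 h13 h01B]
    · linarith [strongSub 3 1 0 2 0 h10 h20 h10B, strongSub 3 1 2 1 3 h12 h13 h01B]
  · linarith [pairSub 1 0 0 4 h44, pairAdd 0 1 1 2 h13, pairSub 0 1 1 3 h12,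
      strongSub 3 4 4 0 4 h44 h04 h10B]

theorem elim_of_le (hc : IsCellCount N c) (hp : c 0 4 ≤ c 0 1)
    (hr : ∑ j, c 2 j + ∑ j, c 3 j ≤ ∑ j, c 1 j + ∑ j, c 4 j)
    (hr' : ∑ j, c 4 j ≤ ∑ j, c 1 j) : False := by
  have hz := hc.lt_zero_row
  have hbig : 3 * N < 5 * c 0 1 := by omega
  have hrow : N < ∑ j, c 1 j := by
    have hsum := hc.lt_sum
    have h0 : ∑ j, c 0 j = c 0 1 + c 0 4 := by
      rw [sum_zmod_five, hc.zero_apply 0 (by decide) (by decide),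
        hc.zero_apply 2 (by decide) (by decide), hc.zero_apply 3 (by decide) (by decide)]
      ring
    rw [sum_zmod_five] at hsum
    have h1 := hc.le 0 1
    have h4 := hc.le 0 4
    omega
  have hadj (j : ZMod 5) (h1 : 0 < c 1 j) (h2 : 0 < c 1 (j + 1)) :
      5 * (c 1 j + c 1 (j + 1)) ≤ 2 * N := by
    have := hc.strong_sub 3 1 j 1 (j + 1) h1 h2 (by rwa [sub_self, add_sub_cancel_left])
    omega
  obtain ⟨a, ha⟩ := exists_shift_row (hc.le 1) hadj hrow
  obtain ⟨d, hd⟩ : ∃ d : ZMod 5 → ZMod 5 → ℕ, ∀ i j, d i j = c i (j + a * i) :=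
    ⟨_, fun _ _ => rfl⟩
  have hdc : IsCellCount N d := by
    have := hc.comp one_ne_zero (.inl rfl) a
    simpa only [one_mul, ← hd] using this
  have hd0 (j : ZMod 5) : d 0 j = c 0 j := by rw [hd, mul_zero, add_zero]
  have hd1 (j : ZMod 5) : c 1 (j + a) = d 1 j := by rw [hd, mul_one]
  have hsum (i : ZMod 5) : ∑ j, c i j = ∑ j, d i j := by
    simp only [hd]
    exact (Equiv.sum_comp (Equiv.addRight (a * i)) (c i)).symm
  rw [← hd0] at hbig
  simp only [hsum, sum_zmod_five] at hr hr'
  have ha0 := hd1 0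
  rw [zero_add] at ha0
  simp only [hd1, ha0] at ha
  rcases ha with ⟨h0, h2, h3, h1, h4, h⟩ | ⟨h1, h4, h0, h2, h3⟩
  · exact hdc.not_two_point_row hbig hr hr' h0 h2 h3 h1 h4 h
  · exact hdc.not_three_point_row hbig hr hr' h1 h4 h0 h2 h3

/-- No function satisfies the constraints of `IsCellCount`. -/
theorem elim (hc : IsCellCount N c) : False := by
  obtain ⟨ε, hε, hp⟩ : ∃ ε : ZMod 5, (ε = 1 ∨ ε = -1) ∧ c 0 (ε * 4) ≤ c 0 (ε * 1) := by
    rcases le_total (c 0 4) (c 0 1) with h | h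
    · exact ⟨1, .inl rfl, h⟩
    · exact ⟨-1, .inr rfl, h⟩
  obtain ⟨u, hu, hr, hr'⟩ : ∃ u : ZMod 5, u ≠ 0 ∧
      ∑ j, c (u * 2) j + ∑ j, c (u * 3) j ≤ ∑ j, c (u * 1) j + ∑ j, c (u * 4) j ∧
      ∑ j, c (u * 4) j ≤ ∑ j, c (u * 1) j := by
    generalize hR : (fun i => ∑ j, c i j) = R
    simp only [funext_iff] at hR
    simp only [hR]
    by_contra! h
    have h1 : R 2 + R 3 ≤ R 1 + R 4 → R 1 < R 4 := h 1 (by decide)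
    have h2 : R 4 + R 1 ≤ R 2 + R 3 → R 2 < R 3 := h 2 (by decide)
    have h3 : R 1 + R 4 ≤ R 3 + R 2 → R 3 < R 2 := h 3 (by decide)
    have h4 : R 3 + R 2 ≤ R 4 + R 1 → R 4 < R 1 := h 4 (by decide)
    omega
  have hrow (i : ZMod 5) : ∑ j, c (u * i) (ε * j) = ∑ j, c (u * i) j := by
    have hε0 : ε ≠ 0 := by rcases hε with rfl | rfl <;> decide
    exact Equiv.sum_comp (Equiv.mulLeft₀ ε hε0) (c (u * i))
  have hc' := hc.comp hu hε 0
  simp only [zero_mul, add_zero] at hc'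
  refine hc'.elim_of_le ?_ ?_ ?_
  · simpa only [mul_zero] using hp
  · simpa only [hrow] using hr
  · simpa only [hrow] using hr'

end IsCellCount

/-- The kernel evaluates arithmetic in `Fin 5` much faster than in `ZMod 5`. -/
theorem not_sumFree_six_points_fin : ∀ k₁ k₂ k₃ k₄ : Fin 5, ∀ S : List (Fin 5 × Fin 5),
    S = [(1, 0), (0, 1), (k₁, k₁), (k₂, k₂ * 2), (k₃, k₃ * 3), (k₄, k₄ * 4)] →
    ∃ x ∈ S, ∃ y ∈ S, x + y ∈ S := by
  simp only [forall_eq]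
  decide +kernel

/-- A sum-free subset of the plane misses a line through the origin. -/
theorem not_sumFree_six_points : ∀ k₁ k₂ k₃ k₄ : ZMod 5, ∀ S : List (ZMod 5 × ZMod 5),
    S = [(1, 0), (0, 1), (k₁, k₁), (k₂, k₂ * 2), (k₃, k₃ * 3), (k₄, k₄ * 4)] →
    ∃ x ∈ S, ∃ y ∈ S, x + y ∈ S :=
  not_sumFree_six_points_fin

theorem card_ker_mul_card {G E : Type*} [AddCommGroup G]
    [Module (ZMod 5) G] [AddCommGroup E] [Module (ZMod 5) E]
    {f : G →ₗ[ZMod 5] E} (hf : Function.Surjective f) :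
    Nat.card (LinearMap.ker f) * Nat.card E = Nat.card G := by
  rw [Submodule.card_eq_card_quotient_mul_card (LinearMap.ker f),
    Nat.card_congr (f.quotKerEquivOfSurjective hf).toEquiv, mul_comm]

theorem card_eq_sum_level {G : Type*} [AddCommGroup G] [Module (ZMod 5) G]
    (g : G →ₗ[ZMod 5] ZMod 5) (A : Finset G) :
    A.card = ∑ i, (A.filter (g · = i)).card :=
  Finset.card_eq_sum_card_fiberwise fun _ _ => Finset.mem_coe.2 (Finset.mem_univ _)

section SumFree

variable {G : Type*} [AddCommGroup G] [Module (ZMod 5) G] [Finite G] {A : Finset G}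

theorem card_filter_apply_eq_le {E : Type*} [AddCommGroup E] [Module (ZMod 5) E] [DecidableEq E]
    (φ : G →ₗ[ZMod 5] E) (x : E) : (A.filter (φ · = x)).card ≤ Nat.card (LinearMap.ker φ) := by
  rcases (A.filter (φ · = x)).eq_empty_or_nonempty with h | ⟨a₀, ha₀⟩
  · simp [h]
  rw [Finset.mem_filter] at ha₀
  rw [← Nat.card_eq_finsetCard]
  refine Nat.card_le_card_of_injective
    (fun a => (⟨a - a₀, ?_⟩ : LinearMap.ker φ)) fun a b hab => ?_
  · have := (Finset.mem_filter.1 a.2).2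
    simp [this, ha₀.2]
  · exact Subtype.ext (sub_left_injective (Subtype.ext_iff.1 hab))

/-- A dense sum-free set with a level set of more than half density is normal. -/
theorem exists_forall_apply_eq_of_lt_level (hA : ∀ a ∈ A, ∀ b ∈ A, a + b ∉ A)
    (g : G →ₗ[ZMod 5] ZMod 5) (hcard : 6 * Nat.card (LinearMap.ker g) < 5 * A.card)
    {i : ZMod 5} (hi : Nat.card (LinearMap.ker g) < 2 * (A.filter (g · = i)).card) :
    ∃ f : G →ₗ[ZMod 5] ZMod 5, ∀ a ∈ A, f a = 1 ∨ f a = 4 := by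
  wlog hi1 : i = 1 generalizing g i
  · have hi0 : i ≠ 0 := by
      rintro rfl
      have hpos : 0 < (A.filter (g · = 0)).card := by omega
      have := (SchurBound.of_fiber g hA hpos hpos (by rwa [add_zero])).mid 0 (by omega)
      rw [add_zero] at this
      omega
    have hker : LinearMap.ker (i⁻¹ • g) = LinearMap.ker g :=
      LinearMap.ker_smul _ _ (inv_ne_zero hi0)
    refine this (i⁻¹ • g) (hker ▸ hcard) (i := 1) ?_ rfl
    rw [hker]
    simpa [inv_mul_eq_one₀ hi0, eq_comm] using hi
  subst hi1
  have hsum := card_eq_sum_level g A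
  rw [sum_zmod_five] at hsum
  set c : ZMod 5 → ℕ := fun j => (A.filter (g · = j)).card with hc
  have hS (x y z : ZMod 5) (hz : x + y = z) (hx : 0 < c x) (hy : 0 < c y) (hxy : 0 < c z) :
      SchurBound (Nat.card (LinearMap.ker g)) (c x) (c y) (c z) := by
    subst hz
    exact .of_fiber g hA hx hy hxy
  have h1 : 0 < c 1 := by simp only [hc]; omega
  have h2 : c 2 = 0 := by
    by_contra h2
    have := (hS 1 1 2 rfl h1 h1 (by omega)).right 0 (by omega)
    simp only [hc] at *
    omega
  have h0 : c 0 = 0 := by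
    by_contra h0
    have := (hS 0 1 1 rfl (by omega) h1 h1).left 0 (by omega)
    simp only [hc] at *
    omega
  have h3 : c 3 = 0 := by
    by_contra h3
    by_cases h4 : c 4 = 0
    · have := (hS 3 3 1 rfl (by omega) (by omega) h1).sum_le
      simp only [hc] at *
      omega
    · have := (hS 1 3 4 rfl h1 (by omega) (by omega)).sum_le
      simp only [hc] at *
      omega
  refine ⟨g, fun a ha => ?_⟩
  have hpos : 0 < c (g a) := Finset.card_pos.2 ⟨a, Finset.mem_filter.2 ⟨ha, rfl⟩⟩
  have : ∀ x : ZMod 5, x = 0 ∨ x = 1 ∨ x = 2 ∨ x = 3 ∨ x = 4 := by decide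
  rcases this (g a) with h | h | h | h | h <;> rw [h] at hpos ⊢ <;> simp_all

theorem exists_forall_smul_notMem (hA : ∀ a ∈ A, ∀ b ∈ A, a + b ∉ A)
    (hcard : 6 * Nat.card G < 25 * A.card)
    (hf : ¬ ∃ f : G →ₗ[ZMod 5] ZMod 5, ∀ a ∈ A, f a = 1 ∨ f a = 4) :
    ∃ e : G, e ≠ 0 ∧ ∀ k : ZMod 5, k • e ∉ A := by
  by_contra! hline
  have h0 : (0 : G) ∉ A := fun h => hA 0 h 0 h (by rwa [add_zero])
  obtain ⟨a, ha⟩ : A.Nonempty := Finset.card_pos.1 (by omega)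
  obtain ⟨g, hga, -⟩ := Submodule.exists_dual_map_eq_bot_of_notMem (p := (⊥ : Submodule (ZMod 5) G))
    (x := a) (by rintro rfl; exact h0 ha) inferInstance
  have hker : LinearMap.ker g = ⊥ := by
    rw [Submodule.eq_bot_iff]
    intro v hv
    by_contra hv0
    obtain ⟨k, hb⟩ := hline v hv0
    set b := k • v
    have hgb : g b = 0 := by simp [b, LinearMap.mem_ker.1 hv]
    have hb0 : b ≠ 0 := fun h => h0 (h ▸ hb)
    have hmem (j : ZMod 5) : ∃ k : ZMod 5, k • a + (k * j) • b ∈ A := by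
      obtain ⟨k, hk⟩ := hline (a + j • b) fun h => hga (by simpa [hgb] using congrArg g h)
      exact ⟨k, by rwa [smul_add, smul_smul] at hk⟩
    obtain ⟨k₁, hk₁⟩ := hmem 1
    obtain ⟨k₂, hk₂⟩ := hmem 2
    obtain ⟨k₃, hk₃⟩ := hmem 3
    obtain ⟨k₄, hk₄⟩ := hmem 4
    rw [mul_one] at hk₁
    obtain ⟨x, hx, y, hy, hxy⟩ := not_sumFree_six_points k₁ k₂ k₃ k₄ _ rfl
    have hS : ∀ x ∈ ([(1, 0), (0, 1), (k₁, k₁), (k₂, k₂ * 2), (k₃, k₃ * 3), (k₄, k₄ * 4)] :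
        List (ZMod 5 × ZMod 5)), x.1 • a + x.2 • b ∈ A := by
      simp [ha, hb, hk₁, hk₂, hk₃, hk₄]
    refine hA _ (hS x hx) _ (hS y hy) ?_
    convert hS _ hxy using 1
    simp only [Prod.fst_add, Prod.snd_add, add_smul]
    abel
  have hker1 : Nat.card (LinearMap.ker g) = 1 := by simp [hker]
  have hG := card_ker_mul_card (LinearMap.surjective (f := g) fun h => hga (by simp [h]))
  rw [Nat.card_zmod] at hG
  have hpos : 0 < (A.filter (g · = g a)).card :=
    Finset.card_pos.2 ⟨a, Finset.mem_filter.2 ⟨ha, rfl⟩⟩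
  exact hf (exists_forall_apply_eq_of_lt_level hA g (by omega) (i := g a) (by omega))

theorem exists_card_le_five_mul_level {e : G} (he : e ≠ 0) (hline : ∀ k : ZMod 5, k • e ∉ A) :
    ∃ g : G →ₗ[ZMod 5] ZMod 5, g e = 1 ∧ A.card ≤ 5 * (A.filter (g · = 0)).card := by
  classical
  have : Finite (G →ₗ[ZMod 5] ZMod 5) := DFunLike.finite _
  have : Fintype (G →ₗ[ZMod 5] ZMod 5) := Fintype.ofFinite _
  set S : Finset (G →ₗ[ZMod 5] ZMod 5) := Finset.univ.filter (· e = 1) with hS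
  have hne : S.Nonempty := by
    obtain ⟨f, hf, -⟩ := Submodule.exists_dual_map_eq_bot_of_notMem
      (p := (⊥ : Submodule (ZMod 5) G)) (x := e) he inferInstance
    exact ⟨(f e)⁻¹ • f, by simp [hS, inv_mul_cancel₀ hf]⟩
  have hS5 : ∀ a ∈ A, 5 * (S.filter (· a = 0)).card = S.card := by
    intro a ha
    obtain ⟨h, hha, hhe⟩ := Submodule.exists_dual_map_eq_bot_of_notMem
      (p := Submodule.span (ZMod 5) {e}) (x := a)
      (fun hm => by
        obtain ⟨k, hk⟩ := Submodule.mem_span_singleton.1 hm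
        exact hline k (hk ▸ ha)) inferInstance
    replace hhe : h e = 0 := (Submodule.mem_bot _).1
      (hhe ▸ Submodule.mem_map_of_mem (Submodule.mem_span_singleton_self e))
    have hlevel (i : ZMod 5) : (S.filter (· a = i)).card = (S.filter (· a = 0)).card := by
      refine Finset.card_nbij' (· - (i * (h a)⁻¹) • h) (· + (i * (h a)⁻¹) • h) ?_ ?_ ?_ ?_
      · intro f hf
        simp_all
      · intro f hf
        simp_all
      · intro f _
        simp
      · intro f _
        simp
    rw [Finset.card_eq_sum_card_fiberwise (s := S) (f := (· a)) (t := Finset.univ)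
      fun _ _ => Finset.mem_coe.2 (Finset.mem_univ _), Finset.sum_congr rfl fun i _ => hlevel i]
    simp [ZMod.card]
  have hdouble : ∑ g ∈ S, A.card ≤ ∑ g ∈ S, 5 * (A.filter (g · = 0)).card := by
    have hswap := Finset.sum_card_bipartiteAbove_eq_sum_card_bipartiteBelow (s := S) (t := A)
      fun g a => g a = 0
    simp only [Finset.bipartiteAbove, Finset.bipartiteBelow] at hswap
    rw [← Finset.mul_sum, hswap, Finset.mul_sum, Finset.sum_congr rfl hS5, Finset.sum_const,
      Finset.sum_const, smul_eq_mul, smul_eq_mul, mul_comm]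
  obtain ⟨g, hg, hle⟩ := Finset.exists_le_of_sum_le hne hdouble
  exact ⟨g, (Finset.mem_filter.1 hg).2, hle⟩

/-- Normality on a large hyperplane section propagates to the whole sum-free set. -/
theorem exists_forall_apply_eq_of_ker (hA : ∀ a ∈ A, ∀ b ∈ A, a + b ∉ A)
    (hcard : 6 * Nat.card G < 25 * A.card) {e : G} {g h : G →ₗ[ZMod 5] ZMod 5} (hge : g e = 1)
    (hlevel : A.card ≤ 5 * (A.filter (g · = 0)).card)
    (hh : ∀ a ∈ A, g a = 0 → h a = 1 ∨ h a = 4) :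
    ∃ f : G →ₗ[ZMod 5] ZMod 5, ∀ a ∈ A, f a = 1 ∨ f a = 4 := by
  by_contra hf
  obtain ⟨a₀, ha₀⟩ : (A.filter (g · = 0)).Nonempty := Finset.card_pos.1 (by omega)
  rw [Finset.mem_filter] at ha₀
  have hha₀ : h a₀ ≠ 0 := by
    rcases hh a₀ ha₀.1 ha₀.2 with h | h <;> rw [h] <;> decide
  have hsurj : Function.Surjective (g.prod h) := by
    rintro ⟨i, j⟩
    refine ⟨i • e + ((j - i * h e) * (h a₀)⁻¹) • a₀, ?_⟩
    simp [hge, ha₀.2, hha₀]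
  set N := Nat.card (LinearMap.ker (g.prod h))
  have hN : N * 25 = Nat.card G := by
    rw [← card_ker_mul_card hsurj, Nat.card_prod, Nat.card_zmod]
  set c : ZMod 5 → ZMod 5 → ℕ := fun i j => (A.filter (g.prod h · = (i, j))).card
  have hc (f : G →ₗ[ZMod 5] ZMod 5) (s : ZMod 5) (u : ZMod 5 → ZMod 5)
      (hu : ∀ a, f a = s ↔ h a = u (g a)) :
      (A.filter (f · = s)).card = ∑ i, c i (u i) := by
    rw [card_eq_sum_level g]
    refine Finset.sum_congr rfl fun i _ => ?_
    rw [Finset.filter_filter]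
    congr 1
    ext a
    simp only [Finset.mem_filter, hu, LinearMap.prod_apply, Function.prod_apply, Prod.mk.injEq]
    grind
  have hrow (i : ZMod 5) : (A.filter (g · = i)).card = ∑ j, c i j := by
    rw [card_eq_sum_level h]
    refine Finset.sum_congr rfl fun j _ => ?_
    rw [Finset.filter_filter]
    congr 1
    ext a
    simp
  have hzero (j : ZMod 5) (h1 : j ≠ 1) (h4 : j ≠ 4) : c 0 j = 0 := by
    refine Finset.card_eq_zero.2 (Finset.filter_eq_empty_iff.2 fun a ha hφ => ?_)
    simp only [LinearMap.prod_apply, Function.prod_apply, Prod.mk.injEq] at hφ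
    rcases hh a ha hφ.1 with h | h
    · exact h1 (hφ.2 ▸ h)
    · exact h4 (hφ.2 ▸ h)
  refine IsCellCount.elim (N := N) (c := c) ⟨fun i j => card_filter_apply_eq_le _ _,
    fun i j k l h1 h2 h3 => .of_fiber (g.prod h) hA h1 h2 h3, fun a s => ?_, hzero, ?_, ?_⟩
  · have hker := card_ker_mul_card (LinearMap.surjective (f := h - a • g) fun h0 => hha₀ (by
      simpa [ha₀.2] using LinearMap.congr_fun h0 a₀))
    rw [Nat.card_zmod] at hker
    rw [← hc (h - a • g) s (fun i => a * i + s) fun x => by simp [sub_eq_iff_eq_add, add_comm]]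
    by_contra! hlt
    exact hf (exists_forall_apply_eq_of_lt_level hA (h - a • g) (by omega) (i := s) (by omega))
  · have := hrow 0
    rw [sum_zmod_five, hzero 0 (by decide) (by decide), hzero 2 (by decide) (by decide),
      hzero 3 (by decide) (by decide)] at this
    omega
  · rw [← Finset.sum_congr rfl fun i _ => hrow i, ← card_eq_sum_level]
    omega

end SumFree

/-- Sum-free sets of density more than `6 / 25` are normal. -/
theorem exists_forall_apply_eq_one_or_four {G : Type*} [AddCommGroup G] [Module (ZMod 5) G]
    [Finite G] {A : Finset G} (hA : ∀ a ∈ A, ∀ b ∈ A, a + b ∉ A)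
    (hcard : 6 * Nat.card G < 25 * A.card) :
    ∃ f : G →ₗ[ZMod 5] ZMod 5, ∀ a ∈ A, f a = 1 ∨ f a = 4 := by
  induction hm : Nat.card G using Nat.strong_induction_on generalizing G with
  | h m ih =>
    classical
    subst hm
    by_contra hf
    obtain ⟨e, he, hline⟩ := exists_forall_smul_notMem hA hcard hf
    obtain ⟨g, hge, hlevel⟩ := exists_card_le_five_mul_level he hline
    have hker := card_ker_mul_card (LinearMap.surjective (f := g) fun h => by simp [h] at hge)
    rw [Nat.card_zmod] at hker
    have hpos : 0 < Nat.card G := Nat.card_pos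
    have hU : (A.filter (g · = 0)).card = (A.subtype (· ∈ LinearMap.ker g)).card := by
      simp [Finset.card_subtype]
    obtain ⟨h₀, hh₀⟩ := ih (Nat.card (LinearMap.ker g)) (by omega)
      (A := A.subtype (· ∈ LinearMap.ker g))
      (fun a ha b hb hab => hA a (Finset.mem_subtype.1 ha) b (Finset.mem_subtype.1 hb)
        (Finset.mem_subtype.1 hab)) (by omega) rfl
    obtain ⟨h, hh⟩ := h₀.exists_extend
    refine hf (exists_forall_apply_eq_of_ker hA hcard hge hlevel (h := h) fun a ha hga => ?_)
    have := hh₀ ⟨a, hga⟩ (Finset.mem_subtype.2 ha)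
    rwa [← hh] at this

end PrimeFive

theorem stmt_6 (n : ℕ) (A : Set (Fin n → ZMod 5))
    (hsf : ∀ a ∈ A, ∀ b ∈ A, a + b ∉ A)
    (hcard : 5 * A.ncard > 6 * 5 ^ (n - 1)) :
    ∃ V : Submodule (ZMod 5) (Fin n → ZMod 5), Module.finrank (ZMod 5) V = n - 1 ∧
      ∃ w : Fin n → ZMod 5, w ∉ V ∧
        A ⊆ ((2 : ZMod 5) • w +ᵥ (V : Set (Fin n → ZMod 5))) ∪
            ((3 : ZMod 5) • w +ᵥ (V : Set (Fin n → ZMod 5))) := by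
  classical
  have h3 : (3 : ZMod 5) ≠ 0 := by decide
  have := fact_prime_five
  have hdensity : 6 * Nat.card (Fin n → ZMod 5) < 25 * A.toFinset.card := by
    rw [← Set.ncard_eq_toFinset_card', Nat.card_fun, Nat.card_zmod, Nat.card_fin]
    rcases n with _ | n
    · have := Set.ncard_le_card A
      simp at this hcard
      omega
    · rw [Nat.add_sub_cancel] at hcard
      rw [pow_succ]
      omega
  obtain ⟨f, hf⟩ := exists_forall_apply_eq_one_or_four (by simpa using hsf) hdensity
  obtain ⟨a, ha⟩ : A.toFinset.Nonempty := Finset.card_pos.1 (by omega)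
  have hf0 : f ≠ 0 := by
    rintro rfl
    have := hf a ha
    revert this
    simp only [LinearMap.zero_apply]
    decide
  obtain ⟨w, hw⟩ := LinearMap.surjective hf0 3
  refine ⟨LinearMap.ker f, ?_, w, ?_, fun x hx => ?_⟩
  · have := Module.Dual.finrank_ker_add_one_of_ne_zero hf0
    rw [Module.finrank_fin_fun] at this
    omega
  · rwa [LinearMap.mem_ker, hw]
  · have hmem (k : ZMod 5) (hk : f x = k * 3) :
        x ∈ k • w +ᵥ (LinearMap.ker f : Set (Fin n → ZMod 5)) :=
      Set.mem_vadd_set.2 ⟨x - k • w, by simp [hw, hk], by simp⟩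
    rcases hf x (Set.mem_toFinset.2 hx) with h | h
    · exact .inl (hmem 2 h)
    · exact .inr (hmem 3 h)
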